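/- arXiv:math/0405372 — 2 statements merged into one kernel-verified Lean document; each statement's English description precedes it below -/
import Mathlib

section
/- The coefficients a_0,…,a_{2D−1} satisfy the quadrature condition (Q) if and only if the operators S_0, S_1 on L²(T) satisfy the Cuntz relations: S_i* S_j = δ_{i,j}·I for i,j ∈ {0,1}, and S_0 S_0* + S_1 S_1* = I. -/
open Complex Finset MeasureTheory AddCircle ContinuousLinearMap

theorem aux_double : MeasurePreserving (fun z : AddCircle (1:ℝ) => z + z)
    (@haarAddCircle (1 : ℝ) _) (@haarAddCircle (1 : ℝ) _) := by
  have h := Measure.measurePreserving_zsmul (@haarAddCircle (1 : ℝ) _) (n := 2) (by norm_num)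
  simpa [two_zsmul] using h

theorem aux_fourier_double (n : ℤ) (z : AddCircle (1:ℝ)) :
    fourier n (z + z) = fourier (2 * n) z := by
  rw [fourier_apply, fourier_apply, mul_comm, mul_zsmul, two_zsmul]

theorem aux_S (N : ℕ) (c : ℤ → ℂ)
    (m : AddCircle (1 : ℝ) → ℂ)
    (hm : ∀ z, m z = ∑ k ∈ Finset.range N, c k * fourier (k : ℤ) z)
    (S : Lp ℂ 2 (@haarAddCircle (1 : ℝ) _) →L[ℂ] Lp ℂ 2 (@haarAddCircle (1 : ℝ) _))
    (hS : ∀ (f : Lp ℂ 2 (@haarAddCircle (1 : ℝ) _)),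
      ⇑(S f) =ᵐ[@haarAddCircle (1 : ℝ) _] fun z => m z * f (z + z)) (n : ℤ) :
    S (fourierLp 2 n) = ∑ k ∈ Finset.range N, c k • fourierLp 2 ((k : ℤ) + 2 * n) := by
  have h1 : ∑ k ∈ Finset.range N, c k • fourierLp (T := (1:ℝ)) 2 ((k : ℤ) + 2 * n)
      = ContinuousMap.toLp (E := ℂ) 2 (@haarAddCircle (1 : ℝ) _) ℂ
        (∑ k ∈ Finset.range N, c k • fourier ((k : ℤ) + 2 * n)) := by
    simp only [fourierLp, map_sum, map_smul]
  rw [h1]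
  apply Lp.ext
  have h2 := aux_double.quasiMeasurePreserving.ae (coeFn_fourierLp (T := (1:ℝ)) 2 n)
  filter_upwards [hS (fourierLp 2 n), h2, ContinuousMap.coeFn_toLp (p := 2) (𝕜 := ℂ) (@haarAddCircle (1 : ℝ) _)
        (∑ k ∈ Finset.range N, c k • fourier ((k : ℤ) + 2 * n))] with z hz1 hz2 hz3
  rw [hz1, hz2, hz3, hm, aux_fourier_double, Finset.sum_mul, ContinuousMap.sum_apply]
  refine Finset.sum_congr rfl fun k _ => ?_
  rw [ContinuousMap.smul_apply, fourier_add, smul_eq_mul, mul_assoc]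

theorem aux_inner (N : ℕ) (c : ℤ → ℂ) (hc : ∀ j : ℤ, j < 0 ∨ (N : ℤ) ≤ j → c j = 0)
    (m : AddCircle (1 : ℝ) → ℂ)
    (hm : ∀ z, m z = ∑ k ∈ Finset.range N, c k * fourier (k : ℤ) z)
    (S : Lp ℂ 2 (@haarAddCircle (1 : ℝ) _) →L[ℂ] Lp ℂ 2 (@haarAddCircle (1 : ℝ) _))
    (hS : ∀ (f : Lp ℂ 2 (@haarAddCircle (1 : ℝ) _)),
      ⇑(S f) =ᵐ[@haarAddCircle (1 : ℝ) _] fun z => m z * f (z + z)) (p n : ℤ) :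
    inner ℂ (fourierBasis (T := (1:ℝ)) p) (S (fourierBasis n)) = c (p - 2 * n) := by
  rw [coe_fourierBasis, aux_S N c m hm S hS, inner_sum]
  simp only [inner_smul_right, orthonormal_iff_ite.mp orthonormal_fourier]
  by_cases h : 0 ≤ p - 2 * n ∧ p - 2 * n < N
  · obtain ⟨q, hq⟩ := Int.eq_ofNat_of_zero_le h.1
    rw [Finset.sum_eq_single q]
    · rw [if_pos (by omega), hq, mul_one]
    · intro b _ hb
      rw [if_neg (by omega), mul_zero]
    · intro hb
      exact absurd (Finset.mem_range.mpr (by omega)) hb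
  · rw [hc _ (by omega)]
    refine Finset.sum_eq_zero fun k hk => ?_
    have := Finset.mem_range.mp hk
    rw [if_neg (by omega), mul_zero]

theorem aux_ext {E : Type*} [NormedAddCommGroup E] [InnerProductSpace ℂ E]
    (b : HilbertBasis ℤ ℂ E) (A B : E →L[ℂ] E)
    (h : ∀ p q, inner ℂ (b p) (A (b q)) = inner ℂ (b p) (B (b q))) : A = B := by
  have hd : Dense (Submodule.span ℂ (Set.range b) : Set E) :=
    Submodule.dense_iff_topologicalClosure_eq_top.mpr b.dense_span
  refine ContinuousLinearMap.ext_on hd ?_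
  rintro _ ⟨q, rfl⟩
  apply b.repr.injective
  ext p
  simpa only [b.repr_apply_apply] using h p q

theorem aux_even_odd (G : ℤ → ℂ) (hG : Summable G) :
    (∑' n, G (2 * n)) + ∑' n, G (2 * n + 1) = ∑' n, G n := by
  have i1 : Function.Injective (fun n : ℤ => 2 * n) := fun x y h => by
    simp only at h; omega
  have i2 : Function.Injective (fun n : ℤ => 2 * n + 1) := fun x y h => by
    simp only at h; omega
  have h1 := (hG.comp_injective i1).hasSum
  have h2 := (hG.comp_injective i2).hasSum
  have h1' := i1.hasSum_range_iff.mpr h1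
  have h2' := i2.hasSum_range_iff.mpr h2
  have hc : IsCompl (Set.range (fun n : ℤ => 2 * n)) (Set.range (fun n : ℤ => 2 * n + 1)) := by
    refine IsCompl.of_eq ?_ ?_
    · refine Set.eq_empty_of_forall_notMem ?_
      rintro x ⟨⟨u, hu⟩, ⟨v, hv⟩⟩
      simp only at hu hv
      omega
    · refine Set.eq_univ_of_forall fun x => ?_
      rcases Int.even_or_odd' x with ⟨u, hu | hu⟩
      · exact Or.inl ⟨u, hu.symm⟩
      · exact Or.inr ⟨u, hu.symm⟩
  exact (h1'.add_isCompl hc h2').tsum_eq.symm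

theorem aux_Q (D : ℕ) (a : ℤ → ℂ)
    (ha : ∀ j : ℤ, j < 0 ∨ (2 * D : ℤ) ≤ j → a j = 0) (r : ℤ) :
    ∑ k ∈ Finset.Icc (0 : ℤ) (2 * D - 1), (starRingEnd ℂ) (a k) * a (k + r)
      = ∑' k, (starRingEnd ℂ) (a k) * a (k + r) := by
  symm
  apply tsum_eq_sum
  intro k hk
  rw [Finset.mem_Icc] at hk
  rw [ha k (by omega), map_zero, zero_mul]

theorem aux_summable (D : ℕ) (a : ℤ → ℂ)
    (ha : ∀ j : ℤ, j < 0 ∨ (2 * D : ℤ) ≤ j → a j = 0) (p r : ℤ) :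
    Summable fun k : ℤ => a (p - k) * (starRingEnd ℂ) (a (r - k)) := by
  apply summable_of_ne_finset_zero (s := Finset.Icc (p - 2 * D) p)
  intro k hk
  rw [Finset.mem_Icc] at hk
  rw [ha (p - k) (by omega), zero_mul]

/-- coefficients of the second filter -/
noncomputable def auxc (D : ℕ) (a : ℤ → ℂ) (k : ℤ) : ℂ :=
  (-1 : ℂ) ^ k * (starRingEnd ℂ) (a (2 * (D : ℤ) - 1 - k))

theorem aux_sign (k : ℤ) : (starRingEnd ℂ) ((-1 : ℂ) ^ k) = (-1) ^ k := by
  rw [map_zpow₀, map_neg, map_one]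

theorem aux_sign_eq (k l : ℤ) (h : Even (k - l)) : (-1 : ℂ) ^ k = (-1) ^ l := by
  have : k = l + (k - l) := by ring
  rw [this, zpow_add₀ (by norm_num), h.neg_one_zpow, mul_one]

theorem aux_sign_neg (k l : ℤ) (h : Odd (k - l)) : (-1 : ℂ) ^ k = - (-1) ^ l := by
  have : k = l + (k - l) := by ring
  rw [this, zpow_add₀ (by norm_num), h.neg_one_zpow, mul_neg_one]

theorem aux_sign_sq (k : ℤ) : (-1 : ℂ) ^ k * (-1) ^ k = 1 := by
  rw [← mul_zpow]; norm_num

theorem aux_00 (a : ℤ → ℂ)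
    (hQ : ∀ l : ℤ, ∑' k, (starRingEnd ℂ) (a k) * a (k + 2 * l) = if l = 0 then 1 else 0)
    (n p : ℤ) :
    ∑' k, (starRingEnd ℂ) (a (k - 2 * n)) * a (k - 2 * p) = if n = p then 1 else 0 := by
  rw [← (Equiv.addRight (2 * n)).tsum_eq]
  have h := hQ (n - p)
  simp only [Equiv.coe_addRight, sub_eq_zero] at h ⊢
  rw [← h]
  refine tsum_congr fun k => ?_
  congr 3 <;> ring

theorem aux_11 (D : ℕ) (a : ℤ → ℂ)
    (hQ : ∀ l : ℤ, ∑' k, (starRingEnd ℂ) (a k) * a (k + 2 * l) = if l = 0 then 1 else 0)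
    (n p : ℤ) :
    ∑' k, (starRingEnd ℂ) (auxc D a (k - 2 * n)) * auxc D a (k - 2 * p)
      = if n = p then 1 else 0 := by
  rw [← (Equiv.subLeft (2 * D - 1 + 2 * p : ℤ)).tsum_eq]
  have h := hQ (n - p)
  simp only [Equiv.subLeft_apply, sub_eq_zero] at h ⊢
  rw [← h]
  refine tsum_congr fun k => ?_
  simp only [auxc, map_mul, aux_sign, Complex.conj_conj]
  rw [aux_sign_eq (2 * D - 1 + 2 * p - k - 2 * n) (2 * D - 1 + 2 * p - k - 2 * p)
      ⟨p - n, by ring⟩,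
    show (2 * D - 1 - (2 * D - 1 + 2 * p - k - 2 * n) : ℤ) = k + 2 * (n - p) by ring,
    show (2 * D - 1 - (2 * D - 1 + 2 * p - k - 2 * p) : ℤ) = k by ring]
  linear_combination ((starRingEnd ℂ) (a k) * a (k + 2 * (n - p))) *
    aux_sign_sq (2 * D - 1 + 2 * p - k - 2 * p)

theorem aux_01 (D : ℕ) (a : ℤ → ℂ) (n p : ℤ) :
    ∑' k, (starRingEnd ℂ) (a (k - 2 * n)) * auxc D a (k - 2 * p) = 0 := by
  have h : ∑' k, (starRingEnd ℂ) (a (k - 2 * n)) * auxc D a (k - 2 * p)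
      = - ∑' k, (starRingEnd ℂ) (a (k - 2 * n)) * auxc D a (k - 2 * p) := by
    conv_lhs => rw [← (Equiv.subLeft (2 * D - 1 + 2 * p + 2 * n : ℤ)).tsum_eq]
    rw [← tsum_neg]
    refine tsum_congr fun k => ?_
    simp only [auxc, Equiv.subLeft_apply]
    rw [aux_sign_neg (2 * D - 1 + 2 * p + 2 * n - k - 2 * p) (k - 2 * p)
      ⟨D - 1 + p + n - k, by ring⟩]
    rw [show (2 * D - 1 - (2 * D - 1 + 2 * p + 2 * n - k - 2 * p) : ℤ) = k - 2 * n by ring,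
      show (2 * D - 1 + 2 * p + 2 * n - k - 2 * n : ℤ) = 2 * D - 1 - (k - 2 * p) by ring]
    ring
  exact self_eq_neg.mp h

theorem aux_complete (D : ℕ) (a : ℤ → ℂ)
    (ha : ∀ j : ℤ, j < 0 ∨ (2 * D : ℤ) ≤ j → a j = 0)
    (hQ : ∀ l : ℤ, ∑' k, (starRingEnd ℂ) (a k) * a (k + 2 * l) = if l = 0 then 1 else 0)
    (p q : ℤ) :
    (∑' n, a (p - 2 * n) * (starRingEnd ℂ) (a (q - 2 * n))) +
      ∑' n, auxc D a (p - 2 * n) * (starRingEnd ℂ) (auxc D a (q - 2 * n))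
      = if p = q then 1 else 0 := by
  rcases Int.even_or_odd (q - p) with ⟨r, hr⟩ | ⟨r, hr⟩
  · obtain rfl : q = p + 2 * r := by omega
    have h2 : ∑' n, auxc D a (p - 2 * n) * (starRingEnd ℂ) (auxc D a (p + 2 * r - 2 * n))
        = ∑' n, a (p - (2 * n + 1)) * (starRingEnd ℂ) (a (p + 2 * r - (2 * n + 1))) := by
      rw [← (Equiv.subLeft (p - D + r : ℤ)).tsum_eq]
      refine tsum_congr fun n => ?_
      simp only [auxc, Equiv.subLeft_apply, map_mul, aux_sign, Complex.conj_conj]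
      rw [aux_sign_eq (p + 2 * r - 2 * (p - D + r - n)) (p - 2 * (p - D + r - n)) ⟨r, by ring⟩,
        show (2 * D - 1 - (p - 2 * (p - D + r - n)) : ℤ) = p + 2 * r - (2 * n + 1) by ring,
        show (2 * D - 1 - (p + 2 * r - 2 * (p - D + r - n)) : ℤ) = p - (2 * n + 1) by ring]
      linear_combination (a (p - (2 * n + 1)) * (starRingEnd ℂ) (a (p + 2 * r - (2 * n + 1)))) *
        aux_sign_sq (p - 2 * (p - D + r - n))
    rw [h2, aux_even_odd (fun k => a (p - k) * (starRingEnd ℂ) (a (p + 2 * r - k)))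
      (aux_summable D a ha _ _), ← (Equiv.subLeft (p + 2 * r : ℤ)).tsum_eq]
    have h := hQ (-r)
    have e : (p = p + 2 * r) ↔ (-r = 0) := by omega
    simp only [e]
    rw [← h]
    refine tsum_congr fun k => ?_
    simp only [Equiv.subLeft_apply]
    rw [mul_comm]
    congr 3 <;> ring
  · obtain rfl : q = p + 2 * r + 1 := by omega
    rw [if_neg (by omega), ← (Equiv.subLeft (p - D + r + 1 : ℤ)).tsum_eq
      (fun n => auxc D a (p - 2 * n) * (starRingEnd ℂ) (auxc D a (p + 2 * r + 1 - 2 * n))),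
      add_eq_zero_iff_eq_neg, ← tsum_neg]
    refine tsum_congr fun n => ?_
    simp only [auxc, Equiv.subLeft_apply, map_mul, aux_sign, Complex.conj_conj]
    rw [aux_sign_neg (p + 2 * r + 1 - 2 * (p - D + r + 1 - n)) (p - 2 * (p - D + r + 1 - n))
        ⟨r, by ring⟩,
      show (2 * D - 1 - (p - 2 * (p - D + r + 1 - n)) : ℤ) = p + 2 * r + 1 - 2 * n by ring,
      show (2 * D - 1 - (p + 2 * r + 1 - 2 * (p - D + r + 1 - n)) : ℤ) = p - 2 * n by ring]
    linear_combination -(a (p - 2 * n) * (starRingEnd ℂ) (a (p + 2 * r + 1 - 2 * n))) *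
        aux_sign_sq (p - 2 * (p - D + r + 1 - n))

/-- The quadrature condition (Q) holds for `a 0, …, a (2D−1)` if and
only if the operators `(S_i f)(z) = m_i(z) f(z²)` on `L²(T)` (with `m₀(z) = ∑ a_k z^k`
and `m₁(z) = ∑ (−1)^k conj(a_{2D−1−k}) z^k`) satisfy the Cuntz relations
`S_i* S_j = δ_{ij} I` and `S₀S₀* + S₁S₁* = I`.  Here `T = ℝ/ℤ` with normalized Haar
measure, `z^k` is realized by the character `fourier k`, and `z ↦ z²` by `z ↦ z + z`. -/
theorem cuntz_wavelet_stmt1 (D : ℕ) (hD : 1 ≤ D) (a : ℤ → ℂ)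
    (ha : ∀ j : ℤ, j < 0 ∨ (2 * D : ℤ) ≤ j → a j = 0)
    (m : Fin 2 → AddCircle (1 : ℝ) → ℂ)
    (hm₀ : ∀ z, m 0 z = ∑ k ∈ Finset.range (2 * D), a k * fourier (k : ℤ) z)
    (hm₁ : ∀ z, m 1 z = ∑ k ∈ Finset.range (2 * D),
        (-1 : ℂ) ^ k * (starRingEnd ℂ) (a (2 * (D : ℤ) - 1 - k)) * fourier (k : ℤ) z)
    (S : Fin 2 → Lp ℂ 2 (@haarAddCircle (1 : ℝ) _) →L[ℂ] Lp ℂ 2 (@haarAddCircle (1 : ℝ) _))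
    (hS : ∀ (i : Fin 2) (f : Lp ℂ 2 (@haarAddCircle (1 : ℝ) _)),
      ⇑(S i f) =ᵐ[@haarAddCircle (1 : ℝ) _] fun z => m i z * f (z + z)) :
    (∀ ℓ : ℤ, ∑ k ∈ Finset.Icc (0 : ℤ) (2 * D - 1),
        (starRingEnd ℂ) (a k) * a (k + 2 * ℓ) = if ℓ = 0 then 1 else 0)
    ↔ ((∀ i j : Fin 2, adjoint (S i) * S j = if i = j then 1 else 0) ∧
       S 0 * adjoint (S 0) + S 1 * adjoint (S 1) = 1) := by
  let b := fourierBasis (T := (1:ℝ))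
  have hb : ∀ i j, inner ℂ (b i) (b j) = if i = j then (1:ℂ) else 0 :=
    orthonormal_iff_ite.mp b.orthonormal
  have hb1 : ∀ i j, inner ℂ (b i) ((1 : Lp ℂ 2 (@haarAddCircle (1 : ℝ) _) →L[ℂ]
      Lp ℂ 2 (@haarAddCircle (1 : ℝ) _)) (b j)) = if i = j then (1:ℂ) else 0 := hb
  have hc1 : ∀ j : ℤ, j < 0 ∨ ((2 * D : ℕ) : ℤ) ≤ j → auxc D a j = 0 := by
    intro j hj
    push_cast at hj
    rw [auxc, ha _ (by omega), map_zero, mul_zero]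
  have I0 : ∀ p n, inner ℂ (b p) (S 0 (b n)) = a (p - 2 * n) :=
    aux_inner (2 * D) a (by push_cast; exact ha) (m 0) hm₀ (S 0) (hS 0)
  have I1 : ∀ p n, inner ℂ (b p) (S 1 (b n)) = auxc D a (p - 2 * n) :=
    aux_inner (2 * D) (auxc D a) hc1 (m 1)
      (by intro z; rw [hm₁ z]; simp only [auxc, zpow_natCast]) (S 1) (hS 1)
  have J0 : ∀ p n, inner ℂ (S 0 (b n)) (b p) = (starRingEnd ℂ) (a (p - 2 * n)) := by
    intro p n; rw [← I0, inner_conj_symm]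
  have J1 : ∀ p n, inner ℂ (S 1 (b n)) (b p) = (starRingEnd ℂ) (auxc D a (p - 2 * n)) := by
    intro p n; rw [← I1, inner_conj_symm]
  have hadj : ∀ i j p q, inner ℂ (b p) ((adjoint (S i) * S j) (b q))
      = ∑' k, inner ℂ (S i (b p)) (b k) * inner ℂ (b k) (S j (b q)) := by
    intro i j p q
    rw [b.tsum_inner_mul_inner, mul_apply_eq_comp, adjoint_inner_right]
  have hadj' : ∀ i p q, inner ℂ (b p) ((S i * adjoint (S i)) (b q))
      = ∑' k, inner ℂ (b p) (S i (b k)) * inner ℂ (S i (b k)) (b q) := by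
    intro i p q
    rw [mul_apply_eq_comp, ← adjoint_inner_left, ← b.tsum_inner_mul_inner]
    simp only [adjoint_inner_left, adjoint_inner_right]
  simp only [aux_Q D a ha]
  constructor
  · intro hQ
    have h01 : adjoint (S 0) * S 1 = 0 := by
      refine aux_ext b _ _ fun p q => ?_
      rw [hadj]
      simp only [J0, I1, aux_01, zero_apply, inner_zero_right]
    refine ⟨?_, ?_⟩
    · intro i j
      fin_cases i <;> fin_cases j
      · refine aux_ext b _ _ fun p q => ?_
        simp only [Fin.zero_eta, if_true, hb1]
        rw [hadj]
        simp only [J0, I0]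
        exact aux_00 a hQ p q
      · simpa using h01
      · have := congrArg star h01
        rw [star_mul, ← ContinuousLinearMap.star_eq_adjoint, star_star, star_zero,
          ContinuousLinearMap.star_eq_adjoint] at this
        simpa using this
      · refine aux_ext b _ _ fun p q => ?_
        simp only [Fin.mk_one, if_true, hb1]
        rw [hadj]
        simp only [J1, I1]
        exact aux_11 D a hQ p q
    · refine aux_ext b _ _ fun p q => ?_
      rw [add_apply, inner_add_right, hadj', hadj', hb1]
      simp only [I0, I1, J0, J1]
      exact aux_complete D a ha hQ p q
  · rintro ⟨h, -⟩ l
    have h0 := hadj 0 0 0 (-l)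
    rw [h 0 0] at h0
    simp only [if_true, hb1, I0, J0] at h0
    have e : (0 = -l) ↔ l = 0 := by omega
    simp only [e] at h0
    rw [h0]
    refine tsum_congr fun k => ?_
    congr 3 <;> ring
end

section
/- The operators S_0, S_1, S_2 satisfy the Cuntz relations S_i* S_j = δ_{i,j}·I and S_0 S_0* + S_1 S_1* + S_2 S_2* = I. For every k ≥ 1 and every (i_1,…,i_k) ∈ {0,1,2}^k, the quantity ‖S_{i_k}*⋯S_{i_1}* e_0‖² equals 0 if some i_j = 1, and equals 2^{−k} otherwise. Consequently, the unique Borel measure μ_0 on [0,1) satisfying μ_0([ξ, ξ + 3^{−k})) = ‖S_{i_k}*⋯S_{i_1}* e_0‖² for all triadic fractions ξ = i_1/3 + ⋯ + i_k/3^k is the restriction to the middle-third Cantor set X₃ of the s-dimensional Hausdorff measure, where s = log 2 / log 3. -/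
open Complex MeasureTheory AddCircle ContinuousLinearMap

/-- The word `S_{i_1} ⋯ S_{i_k}` (leftmost factor `S_{i_1}`) for a triple of operators;
its adjoint is `S_{i_k}* ⋯ S_{i_1}*`. -/
noncomputable def cuntzWord3 {H : Type*} [NormedAddCommGroup H] [InnerProductSpace ℂ H]
    (S : Fin 3 → H →L[ℂ] H) {k : ℕ} (i : Fin k → Fin 3) : H →L[ℂ] H :=
  ((List.ofFn i).map S).prod

/-- The triadic rational `ξ = i₁/3 + ⋯ + i_k/3^k`. -/
noncomputable def triadicVal {k : ℕ} (i : Fin k → Fin 3) : ℝ :=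
  ∑ j : Fin k, ((i j : ℕ) : ℝ) * (3⁻¹ : ℝ) ^ ((j : ℕ) + 1)

theorem cw_S_fourier
    (m : Fin 3 → AddCircle (1 : ℝ) → ℂ)
    (S : Fin 3 → Lp ℂ 2 (@haarAddCircle (1 : ℝ) _) →L[ℂ] Lp ℂ 2 (@haarAddCircle (1 : ℝ) _))
    (hS : ∀ (i : Fin 3) (f : Lp ℂ 2 (@haarAddCircle (1 : ℝ) _)),
      ⇑(S i f) =ᵐ[@haarAddCircle (1 : ℝ) _] fun z => m i z * f ((3 : ℕ) • z)) (i : Fin 3) (n : ℤ) :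
    ⇑(S i (fourierLp 2 n)) =ᵐ[@haarAddCircle (1 : ℝ) _] fun z => m i z * fourier (3 * n) z := by
  have hmp : MeasurePreserving (fun z : AddCircle (1:ℝ) => (3 : ℕ) • z)
      (@haarAddCircle (1 : ℝ) _) (@haarAddCircle (1 : ℝ) _) :=
    by
    have hfun : (fun z : AddCircle (1:ℝ) => (3 : ℕ) • z) = fun z => (3 : ℤ) • z := by
      ext z; exact (natCast_zsmul z 3).symm
    rw [hfun]
    exact MeasureTheory.Measure.measurePreserving_zsmul (haarAddCircle (T := (1:ℝ))) (n := 3) (by norm_num)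
  have h1 := hmp.quasiMeasurePreserving.ae_eq (coeFn_fourierLp (T := (1:ℝ)) 2 n)
  filter_upwards [hS i (fourierLp 2 n), h1] with z hz h2
  have h3 : (fourierLp (T := (1:ℝ)) 2 n) ((3:ℕ) • z) = fourier n ((3:ℕ) • z) := h2
  rw [hz, h3]
  congr 1
  simp only [fourier_apply]
  congr 2
  rw [mul_comm, mul_zsmul]
  rfl

theorem cw_ops
    (m : Fin 3 → AddCircle (1 : ℝ) → ℂ)
    (hm₀ : ∀ z, m 0 z = (1 + fourier (2 : ℤ) z) / (Real.sqrt 2 : ℂ))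
    (hm₁ : ∀ z, m 1 z = fourier (1 : ℤ) z)
    (hm₂ : ∀ z, m 2 z = (1 - fourier (2 : ℤ) z) / (Real.sqrt 2 : ℂ))
    (S : Fin 3 → Lp ℂ 2 (@haarAddCircle (1 : ℝ) _) →L[ℂ] Lp ℂ 2 (@haarAddCircle (1 : ℝ) _))
    (hS : ∀ (i : Fin 3) (f : Lp ℂ 2 (@haarAddCircle (1 : ℝ) _)),
      ⇑(S i f) =ᵐ[@haarAddCircle (1 : ℝ) _] fun z => m i z * f ((3 : ℕ) • z)) (n : ℤ) :
    S 0 (fourierLp 2 n) = (Real.sqrt 2 : ℂ)⁻¹ • (fourierLp 2 (3*n) + fourierLp 2 (3*n+2)) ∧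
    S 1 (fourierLp 2 n) = fourierLp 2 (3*n+1) ∧
    S 2 (fourierLp 2 n) = (Real.sqrt 2 : ℂ)⁻¹ • (fourierLp 2 (3*n) - fourierLp 2 (3*n+2)) := by
  have hc := fun k => coeFn_fourierLp (T := (1:ℝ)) 2 k
  refine ⟨?_, ?_, ?_⟩
  · apply Lp.ext
    filter_upwards [cw_S_fourier m S hS 0 n, hc (3*n), hc (3*n+2),
      Lp.coeFn_smul (Real.sqrt 2 : ℂ)⁻¹ (fourierLp (T := (1:ℝ)) 2 (3*n) + fourierLp 2 (3*n+2)),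
      Lp.coeFn_add (fourierLp (T := (1:ℝ)) 2 (3*n)) (fourierLp 2 (3*n+2))] with z h1 h2 h3 h4 h5
    rw [h1, h4, Pi.smul_apply, h5, Pi.add_apply, h2, h3, hm₀, fourier_add, smul_eq_mul]
    ring
  · apply Lp.ext
    filter_upwards [cw_S_fourier m S hS 1 n, hc (3*n+1)] with z h1 h2
    rw [h1, h2, hm₁, fourier_add]
    ring
  · apply Lp.ext
    filter_upwards [cw_S_fourier m S hS 2 n, hc (3*n), hc (3*n+2),
      Lp.coeFn_smul (Real.sqrt 2 : ℂ)⁻¹ (fourierLp (T := (1:ℝ)) 2 (3*n) - fourierLp 2 (3*n+2)),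
      Lp.coeFn_sub (fourierLp (T := (1:ℝ)) 2 (3*n)) (fourierLp 2 (3*n+2))] with z h1 h2 h3 h4 h5
    rw [h1, h4, Pi.smul_apply, h5, Pi.sub_apply, h2, h3, hm₂, fourier_add, smul_eq_mul]
    ring

theorem cw_sqrt : (Real.sqrt 2 : ℂ)⁻¹ * (Real.sqrt 2 : ℂ)⁻¹ = 1/2 := by
  rw [← mul_inv, ← Complex.ofReal_mul, Real.mul_self_sqrt (by norm_num)]; norm_num

/-- abstract version -/
theorem cw_abstract {H : Type*} [NormedAddCommGroup H] [InnerProductSpace ℂ H] [CompleteSpace H]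
    (e : ℤ → H) (he : Orthonormal ℂ e)
    (hd : (Submodule.span ℂ (Set.range e)).topologicalClosure = ⊤) (S : Fin 3 → H →L[ℂ] H)
    (h0 : ∀ n, S 0 (e n) = (Real.sqrt 2 : ℂ)⁻¹ • (e (3*n) + e (3*n+2)))
    (h1 : ∀ n, S 1 (e n) = e (3*n+1))
    (h2 : ∀ n, S 2 (e n) = (Real.sqrt 2 : ℂ)⁻¹ • (e (3*n) - e (3*n+2))) :
    ((∀ i j : Fin 3, adjoint (S i) * S j = if i = j then 1 else 0) ∧
      ∑ i : Fin 3, S i * adjoint (S i) = 1) ∧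
    (∀ d : Fin 3, adjoint (S d) (e 0) = (if d = 1 then 0 else (Real.sqrt 2 : ℂ)⁻¹) • e 0) := by
  have hdense : Dense (Submodule.span ℂ (Set.range e) : Set H) :=
    (Submodule.dense_iff_topologicalClosure_eq_top).2 hd
  have hext : ∀ A B : H →L[ℂ] H, (∀ n, A (e n) = B (e n)) → A = B := by
    intro A B h
    apply ContinuousLinearMap.ext_on hdense
    rintro _ ⟨n, rfl⟩
    exact h n
  have hin := orthonormal_iff_ite.1 he
  have hzero : ∀ v : H, (∀ n, inner ℂ (e n) v = 0) → v = 0 := by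
    intro v hv
    have : innerSL ℂ v = 0 := by
      apply ContinuousLinearMap.ext_on hdense
      rintro _ ⟨n, rfl⟩
      simp only [innerSL_apply_apply, _root_.zero_apply]
      rw [← inner_conj_symm, hv]; simp
    have h := congrArg (fun f => f v) this
    simpa using h
  have hs := cw_sqrt
  have hrel : ∀ i j : Fin 3, adjoint (S i) * S j = if i = j then 1 else 0 := by
    intro i j
    apply hext
    intro n
    rw [← sub_eq_zero]
    apply hzero
    intro k
    rw [inner_sub_right, mul_apply_eq_comp, ContinuousLinearMap.adjoint_inner_right]
    have a1 : (3 * k = 3 * n) ↔ k = n := by omega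
    have a2 : ¬ (3 * k = 3 * n + 2) := by omega
    have a3 : ¬ (3 * k + 2 = 3 * n) := by omega
    have a4 : ¬ (3 * k + 1 = 3 * n) := by omega
    have a5 : ¬ (3 * k = 3 * n + 1) := by omega
    have a6 : ¬ (3 * k + 2 = 3 * n + 1) := by omega
    have a7 : ¬ (3 * k + 1 = 3 * n + 2) := by omega
    fin_cases i <;> fin_cases j <;>
    simp [h0, h1, h2, inner_add_left, inner_add_right, inner_sub_left, inner_sub_right,
      inner_smul_left, inner_smul_right, hin, a1, a2, a3, a4, a5, a6, a7, -mul_eq_zero, -mul_eq_mul_left_iff] <;>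
    split_ifs <;> (try simp) <;> (try linear_combination 2 * hs)
  have h2e : ∀ n, e (3*n) = (Real.sqrt 2 : ℂ)⁻¹ • (S 0 (e n) + S 2 (e n)) := by
    intro n
    rw [h0, h2, ← smul_add, smul_smul, hs, add_add_sub_cancel, ← two_smul ℂ, smul_smul]
    norm_num
  have h3e : ∀ n, e (3*n+2) = (Real.sqrt 2 : ℂ)⁻¹ • (S 0 (e n) - S 2 (e n)) := by
    intro n
    rw [h0, h2, ← smul_sub, smul_smul, hs, add_sub_sub_cancel, ← two_smul ℂ, smul_smul]
    norm_num
  have hap : ∀ i j v, adjoint (S i) (S j v) = if i = j then v else 0 := by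
    intro i j v
    rw [← mul_apply_eq_comp, hrel]
    split_ifs <;> simp
  refine ⟨⟨hrel, ?_⟩, ?_⟩
  · have hP : ∀ j v, (∑ i : Fin 3, S i * adjoint (S i)) (S j v) = S j v := by
      intro j v
      simp only [_root_.sum_apply, mul_apply_eq_comp, hap]
      rw [Finset.sum_eq_single j] <;> simp +contextual
    apply hext
    intro n
    obtain ⟨q, rfl | rfl | rfl⟩ : ∃ q, n = 3*q ∨ n = 3*q+1 ∨ n = 3*q+2 := ⟨n/3, by omega⟩
    · rw [h2e, map_smul, map_add, hP, hP]; rfl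
    · rw [← h1, hP]; rfl
    · rw [h3e, map_smul, map_sub, hP, hP]; rfl
  · intro d
    have := h2e 0
    rw [mul_zero] at this
    conv_lhs => rw [this]
    rw [map_smul, map_add, hap, hap]
    fin_cases d <;> simp

theorem cw_norm {H : Type*} [NormedAddCommGroup H] [InnerProductSpace ℂ H] [CompleteSpace H]
    (e : H) (he : ‖e‖ = 1) (S : Fin 3 → H →L[ℂ] H)
    (h : ∀ d : Fin 3, adjoint (S d) e = (if d = 1 then 0 else (Real.sqrt 2 : ℂ)⁻¹) • e) :
    ∀ (k : ℕ) (i : Fin k → Fin 3), ‖adjoint (cuntzWord3 S i) e‖ ^ 2 =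
        if ∃ j, i j = 1 then 0 else (2⁻¹ : ℝ) ^ k := by
  intro k
  induction k with
  | zero => intro i; simp [cuntzWord3, he, ← ContinuousLinearMap.star_eq_adjoint]
  | succ k ih =>
    intro i
    have hw : cuntzWord3 S i = S (i 0) * cuntzWord3 S (fun j => i j.succ) := by
      simp [cuntzWord3, List.ofFn_succ]
    have hadj : adjoint (cuntzWord3 S i) e
        = adjoint (cuntzWord3 S (fun j => i j.succ)) (adjoint (S (i 0)) e) := by
      rw [hw, ← ContinuousLinearMap.star_eq_adjoint, star_mul]
      rfl
    rw [hadj, h, map_smul, norm_smul, mul_pow, ih]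
    simp only [Fin.exists_fin_succ]
    by_cases h1 : i 0 = 1
    · simp [h1]
    · by_cases h2 : ∃ j : Fin k, i j.succ = 1
      · simp [h2]
      · have hq : |Real.sqrt 2|⁻¹ * |Real.sqrt 2|⁻¹ = 2⁻¹ := by
          rw [← mul_inv, abs_mul_abs_self, Real.mul_self_sqrt (by norm_num)]
        simp [h1, h2, pow_succ, mul_comm, hq]

noncomputable abbrev cwS : ℝ := Real.log 2 / Real.log 3

theorem cwS_pos : 0 < cwS := div_pos (Real.log_pos (by norm_num)) (Real.log_pos (by norm_num))

theorem cwS_le : cwS ≤ 1 := by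
  rw [cwS, div_le_one (Real.log_pos (by norm_num))]
  exact Real.log_le_log (by norm_num) (by norm_num)

theorem cw_three : (3:ℝ) ^ cwS = 2 := by
  rw [Real.rpow_def_of_pos (by norm_num), cwS, mul_div_cancel₀ _ (Real.log_pos (by norm_num)).ne',
    Real.exp_log (by norm_num)]

theorem cw_div_three (x : ℝ) (hx : 0 ≤ x) : (x / 3) ^ cwS = x ^ cwS / 2 := by
  rw [Real.div_rpow hx (by norm_num), cw_three]

theorem cw_concave (u v : ℝ) (hu : 0 ≤ u) (hv : 0 ≤ v) :
    (u ^ cwS + v ^ cwS) / 2 ≤ ((u + v) / 2) ^ cwS := by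
  have h := (Real.concaveOn_rpow cwS_pos.le cwS_le).2 hu hv
    (by norm_num : (0:ℝ) ≤ 1/2) (by norm_num : (0:ℝ) ≤ 1/2) (by norm_num)
  simp only [smul_eq_mul] at h
  calc _ = 1/2 * u ^ cwS + 1/2 * v ^ cwS := by ring
    _ ≤ _ := h
    _ = _ := by congr 1; ring

theorem cw_limit {a b : ℝ} (h : ∀ n : ℕ, a ≤ b + (1/2)^n) : a ≤ b := by
  have ht : Filter.Tendsto (fun n : ℕ => b + (1/2:ℝ)^n) Filter.atTop (nhds (b + 0)) :=
    tendsto_const_nhds.add (tendsto_pow_atTop_nhds_zero_of_lt_one (by norm_num) (by norm_num))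
  rw [add_zero] at ht
  exact ge_of_tendsto' ht h

theorem cw_one_sided {A : Type*} (x y : A → ℝ) (hx : ∀ a, x a ∈ Set.Icc (0:ℝ) 1)
    (hy : ∀ a, y a ∈ Set.Icc (0:ℝ) 1)
    (hr : ∀ a, ∃ a', (x a = x a' / 3 ∧ y a = y a' / 2) ∨
      (x a = (2 + x a') / 3 ∧ y a = (1 + y a') / 2)) (a : A) : y a ≤ x a ^ cwS := by
  apply cw_limit
  intro n
  induction n generalizing a with
  | zero =>
    have := Real.rpow_nonneg (hx a).1 cwS
    have := (hy a).2
    simp only [pow_zero]; linarith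
  | succ n ih =>
    obtain ⟨a', ⟨h1, h2⟩ | ⟨h1, h2⟩⟩ := hr a
    · have := ih a'
      rw [h1, h2, cw_div_three _ (hx a').1, pow_succ]
      linarith
    · have := ih a'
      have hc := cw_concave 1 (x a') (by norm_num) (hx a').1
      have hm : ((1 + x a') / 2) ^ cwS ≤ ((2 + x a') / 3) ^ cwS := by
        apply Real.rpow_le_rpow _ _ cwS_pos.le
        · linarith [(hx a').1]
        · linarith [(hx a').2]
      rw [Real.one_rpow] at hc
      rw [h1, h2, pow_succ]
      linarith

theorem cw_two_sided {A : Type*} (x y : A → ℝ) (hx : ∀ a, x a ∈ Set.Icc (0:ℝ) 1)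
    (hy : ∀ a, y a ∈ Set.Icc (0:ℝ) 1)
    (hr : ∀ a, ∃ a', (x a = x a' / 3 ∧ y a = y a' / 2) ∨
      (x a = (2 + x a') / 3 ∧ y a = (1 + y a') / 2)) (a b : A) :
    |y a - y b| ≤ |x a - x b| ^ cwS := by
  have h1 := cw_one_sided x y hx hy hr
  have h2 := cw_one_sided (fun a => 1 - x a) (fun a => 1 - y a)
    (fun a => ⟨by linarith [(hx a).2], by linarith [(hx a).1]⟩)
    (fun a => ⟨by linarith [(hy a).2], by linarith [(hy a).1]⟩)
    (by
      intro a
      obtain ⟨a', ⟨h1, h2⟩ | ⟨h1, h2⟩⟩ := hr a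
      · exact ⟨a', Or.inr ⟨by rw [h1]; ring, by rw [h2]; ring⟩⟩
      · exact ⟨a', Or.inl ⟨by rw [h1]; ring, by rw [h2]; ring⟩⟩)
  have key : ∀ a b, |(1 + y a) / 2 - y b / 2| ≤ |(2 + x a) / 3 - x b / 3| ^ cwS := by
    intro a b
    rw [abs_of_nonneg (by linarith [(hy a).1, (hy b).2]),
      abs_of_nonneg (by linarith [(hx a).1, (hx b).2])]
    have hc := cw_concave (x a) (1 - x b) (hx a).1 (by linarith [(hx b).2])
    have hm : ((x a + (1 - x b)) / 2) ^ cwS ≤ ((2 + x a) / 3 - x b / 3) ^ cwS := by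
      apply Real.rpow_le_rpow _ _ cwS_pos.le
      · linarith [(hx a).1, (hx b).2]
      · linarith [(hx a).2, (hx b).1]
    have := h1 a
    have := h2 b
    linarith
  apply cw_limit
  intro n
  induction n generalizing a b with
  | zero =>
    have := Real.rpow_nonneg (abs_nonneg (x a - x b)) cwS
    have : |y a - y b| ≤ 1 := by
      rw [abs_le]; constructor <;> linarith [(hy a).2, (hy b).2, (hy a).1, (hy b).1]
    simp only [pow_zero]; linarith
  | succ n ih =>
    have hp : (0:ℝ) ≤ (1/2)^(n+1) := by positivity
    have hsame : ∀ a b, |y a / 2 - y b / 2| ≤ |x a / 3 - x b / 3| ^ cwS + (1/2)^(n+1) := by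
      intro a b
      rw [← sub_div, ← sub_div, abs_div, abs_div, abs_of_pos (by norm_num : (0:ℝ) < 3),
        abs_of_pos (by norm_num : (0:ℝ) < 2), cw_div_three _ (abs_nonneg _), pow_succ]
      linarith [ih a b]
    obtain ⟨a', ⟨ha1, ha2⟩ | ⟨ha1, ha2⟩⟩ := hr a <;>
    obtain ⟨b', ⟨hb1, hb2⟩ | ⟨hb1, hb2⟩⟩ := hr b <;>
    rw [ha1, ha2, hb1, hb2]
    · exact hsame a' b'
    · rw [abs_sub_comm, abs_sub_comm (x a' / 3)]
      linarith [key b' a']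
    · linarith [key a' b']
    · have e1 : (1 + y a') / 2 - (1 + y b') / 2 = y a' / 2 - y b' / 2 := by ring
      have e2 : (2 + x a') / 3 - (2 + x b') / 3 = x a' / 3 - x b' / 3 := by ring
      rw [e1, e2]
      exact hsame a' b'

noncomputable def cwX (a : ℕ → Bool) : ℝ := Real.ofDigits (fun i ↦ cond (a i) (2 : Fin 3) 0)
noncomputable def cwY (a : ℕ → Bool) : ℝ := Real.ofDigits (fun i ↦ cond (a i) (1 : Fin 2) 0)

theorem cw_holder (a b : ℕ → Bool) : |cwY a - cwY b| ≤ |cwX a - cwX b| ^ cwS := by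
  apply cw_two_sided cwX cwY
  · exact fun a => ⟨Real.ofDigits_nonneg _, Real.ofDigits_le_one _⟩
  · exact fun a => ⟨Real.ofDigits_nonneg _, Real.ofDigits_le_one _⟩
  · intro a
    refine ⟨fun i => a (i + 1), ?_⟩
    have h1 := Real.ofDigits_eq_sum_add_ofDigits (fun i ↦ cond (a i) (2 : Fin 3) 0) 1
    have h2 := Real.ofDigits_eq_sum_add_ofDigits (fun i ↦ cond (a i) (1 : Fin 2) 0) 1
    unfold cwX cwY
    rw [h1, h2]
    cases h : a 0
    · left
      constructor <;> simp [Real.ofDigitsTerm, h] <;> ring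
    · right
      constructor <;> simp [Real.ofDigitsTerm, h] <;> ring

theorem cw_lower : 1 ≤ (μH[cwS] : Measure ℝ) cantorSet := by
  have hX : ∀ t ∈ cantorSet, cwX (cantorToBinary t).get = t := by
    intro t ht
    exact ofDigits_cantorToTernary ht
  set f : ℝ → ℝ := fun t => cwY (cantorToBinary t).get with hf
  obtain ⟨r, hr⟩ : ∃ r : NNReal, (r : ℝ) = cwS := ⟨cwS.toNNReal, Real.coe_toNNReal _ cwS_pos.le⟩
  have hh : HolderOnWith 1 r f cantorSet := by
    intro x hx y hy
    rw [edist_dist, edist_dist, Real.dist_eq, Real.dist_eq]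
    have h := cw_holder (cantorToBinary x).get (cantorToBinary y).get
    rw [hX x hx, hX y hy] at h
    rw [ENNReal.coe_one, one_mul, hr, ENNReal.ofReal_rpow_of_nonneg (abs_nonneg _) (by exact cwS_pos.le)]
    exact ENNReal.ofReal_le_ofReal h
  have h1 := hh.hausdorffMeasure_image_le (by rw [← NNReal.coe_pos, hr]; exact cwS_pos) (d := 1) (by norm_num)
  have h2 : Set.Icc (0:ℝ) 1 ⊆ f '' cantorSet := by
    intro y hy
    obtain ⟨d, -, hd⟩ := Real.ofDigits_SurjOn (b := 2) (by norm_num) hy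
    set a : ℕ → Bool := fun i => decide (d i = 1) with ha
    have hYa : cwY a = y := by
      rw [← hd, cwY]
      congr 1
      ext i
      have : d i = 0 ∨ d i = 1 := by omega
      rcases this with h | h <;> simp [ha, h]
    have hmem : cwX a ∈ cantorSet := ofDigits_bool_to_fin_three_mem_cantorSet a
    refine ⟨cwX a, hmem, ?_⟩
    have := cw_holder (cantorToBinary (cwX a)).get a
    rw [hX _ hmem, sub_self, abs_zero, Real.zero_rpow cwS_pos.ne'] at this
    have h3 := abs_eq_zero.1 (le_antisymm this (abs_nonneg _))
    rw [hf, ← hYa]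
    simp only
    linarith
  have h3 := (measure_mono h2).trans h1
  rw [hausdorffMeasure_real] at h3
  rw [hr, mul_one] at h3
  simpa using h3

theorem cw_triadic_cons {k : ℕ} (i : Fin (k+1) → Fin 3) :
    triadicVal i = (((i 0 : ℕ) : ℝ) + triadicVal (fun j => i j.succ)) / 3 := by
  unfold triadicVal
  rw [Fin.sum_univ_succ, add_div, Finset.sum_div]
  congr 1
  · simp; ring
  · apply Finset.sum_congr rfl
    intro j _
    simp [pow_succ]; ring

theorem cw_mem_cantor (x : ℝ) : x ∈ cantorSet ↔
    (∃ y ∈ cantorSet, x = y / 3) ∨ (∃ y ∈ cantorSet, x = (2 + y) / 3) := by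
  conv_lhs => rw [cantorSet_eq_union_halves]
  simp [eq_comm]

theorem cw_cover (n : ℕ) (x : ℝ) (hx : x ∈ cantorSet) : ∃ w : Fin n → Bool,
    x ∈ Set.Icc (triadicVal (fun j => cond (w j) (2 : Fin 3) 0))
      (triadicVal (fun j => cond (w j) (2 : Fin 3) 0) + (3⁻¹:ℝ)^n) := by
  induction n generalizing x with
  | zero =>
    refine ⟨fun _ => true, ?_⟩
    simpa [triadicVal] using cantorSet_subset_unitInterval hx
  | succ n ih =>
    rcases (cw_mem_cantor x).1 hx with ⟨y, hy, rfl⟩ | ⟨y, hy, rfl⟩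
    · obtain ⟨w, hw1, hw2⟩ := ih y hy
      refine ⟨Fin.cons false w, ?_⟩
      rw [cw_triadic_cons]
      simp only [Fin.cons_zero, Fin.cons_succ, pow_succ, cond_false, Set.mem_Icc]
      constructor
      · simp; linarith
      · simp at hw2 ⊢; linarith
    · obtain ⟨w, hw1, hw2⟩ := ih y hy
      refine ⟨Fin.cons true w, ?_⟩
      rw [cw_triadic_cons]
      simp only [Fin.cons_zero, Fin.cons_succ, pow_succ, cond_true, Set.mem_Icc]
      constructor
      · simp; linarith
      · simp at hw2 ⊢; linarith

theorem cw_upper : (μH[cwS] : Measure ℝ) cantorSet ≤ 1 := by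
  have hd : ∀ (a : ℝ) (n : ℕ), Metric.ediam (Set.Icc a (a + (3⁻¹:ℝ)^n)) = ENNReal.ofReal ((3⁻¹:ℝ)^n) := by
    intro a n
    rw [Real.ediam_Icc]; congr 1; ring
  have h := Measure.hausdorffMeasure_le_liminf_sum (ι := fun n : ℕ => (Fin n → Bool)) cwS cantorSet
    (l := Filter.atTop) (fun n => ENNReal.ofReal ((3⁻¹:ℝ)^n)) (by
      have : Filter.Tendsto (fun n : ℕ => (3⁻¹:ℝ)^n) Filter.atTop (nhds 0) :=
        tendsto_pow_atTop_nhds_zero_of_lt_one (by norm_num) (by norm_num)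
      simpa using ENNReal.tendsto_ofReal this)
    (fun n w => Set.Icc (triadicVal (fun j => cond (w j) (2 : Fin 3) 0))
      (triadicVal (fun j => cond (w j) (2 : Fin 3) 0) + (3⁻¹:ℝ)^n))
    (Filter.Eventually.of_forall fun n i => (hd _ n).le)
    (Filter.Eventually.of_forall fun n x hx => by
      obtain ⟨w, hw⟩ := cw_cover n x hx
      exact Set.mem_iUnion.2 ⟨w, hw⟩)
  refine h.trans ?_
  have hc : ∀ n : ℕ, ∑ w : Fin n → Bool, Metric.ediam (Set.Icc (triadicVal (fun j => cond (w j) (2 : Fin 3) 0))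
      (triadicVal (fun j => cond (w j) (2 : Fin 3) 0) + (3⁻¹:ℝ)^n)) ^ cwS = 1 := by
    intro n
    simp only [hd]
    rw [Finset.sum_const, ENNReal.ofReal_rpow_of_nonneg (by positivity) cwS_pos.le]
    have : ((3⁻¹:ℝ)^n) ^ cwS = (2⁻¹)^n := by
      rw [← Real.rpow_natCast, ← Real.rpow_mul (by norm_num), mul_comm, Real.rpow_mul (by norm_num),
        Real.inv_rpow (by norm_num), cw_three, Real.rpow_natCast]
    rw [this, nsmul_eq_mul, ← ENNReal.ofReal_natCast, ← ENNReal.ofReal_mul (by positivity)]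
    simp
  simp only [hc]
  simp

theorem cw_cantor_measure : (μH[cwS] : Measure ℝ) cantorSet = 1 := le_antisymm cw_upper cw_lower

open Pointwise in
theorem cw_scale (c : ℝ) (T : Set ℝ) :
    (μH[cwS] : Measure ℝ) ((fun x => (c + x) / 3) '' T) = ENNReal.ofReal (2⁻¹) * μH[cwS] T := by
  have h1 : (fun x : ℝ => (c + x) / 3) '' T = (IsometryEquiv.addLeft (c/3)) '' ((3⁻¹:ℝ) • T) := by
    rw [← Set.image_smul, Set.image_image]
    congr 1
    ext x
    simp; ring
  rw [h1, IsometryEquiv.hausdorffMeasure_image,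
    Measure.hausdorffMeasure_smul₀ cwS_pos.le (by norm_num)]
  rw [ENNReal.smul_def, smul_eq_mul]
  congr 1
  rw [ENNReal.ofReal]
  congr 1
  apply NNReal.coe_injective
  push_cast
  rw [Real.coe_toNNReal _ (by norm_num), norm_inv, Real.norm_of_nonneg (by norm_num),
    Real.inv_rpow (by norm_num), cw_three]

theorem cw_triadic_bounds {k : ℕ} (i : Fin k → Fin 3) :
    0 ≤ triadicVal i ∧ triadicVal i + (3⁻¹:ℝ)^k ≤ 1 := by
  induction k with
  | zero => simp [triadicVal]
  | succ k ih =>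
    have h := ih (fun j => i j.succ)
    rw [cw_triadic_cons, pow_succ]
    have h2 : ((i 0 : ℕ) : ℝ) ≤ 2 := by
      have := (i 0).2
      exact_mod_cast (by omega : (i 0 : ℕ) ≤ 2)
    have h3 : (0:ℝ) ≤ ((i 0 : ℕ) : ℝ) := by positivity
    constructor <;> linarith [h.1, h.2]

theorem cw_singleton (x : ℝ) : (μH[cwS] : Measure ℝ) {x} = 0 := by
  have := Measure.nullSingletonClass_hausdorff ℝ cwS_pos
  exact measure_singleton x

theorem cw_interval {k : ℕ} (i : Fin k → Fin 3) :
    (μH[cwS] : Measure ℝ) (cantorSet ∩ Set.Ico (triadicVal i) (triadicVal i + (3⁻¹ : ℝ) ^ k)) =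
      ENNReal.ofReal (if ∃ j, i j = 1 then 0 else (2⁻¹ : ℝ) ^ k) := by
  induction k with
  | zero =>
    have h0 : triadicVal i = 0 := by simp [triadicVal]
    have : cantorSet ∩ Set.Ico (triadicVal i) (triadicVal i + (3⁻¹ : ℝ) ^ 0) = cantorSet \ {1} := by
      ext x
      simp only [h0, pow_zero, zero_add, Set.mem_inter_iff, Set.mem_Ico, Set.mem_sdiff,
        Set.mem_singleton_iff]
      constructor
      · rintro ⟨h1, h2, h3⟩
        exact ⟨h1, h3.ne⟩
      · rintro ⟨h1, h2⟩
        have := cantorSet_subset_unitInterval h1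
        exact ⟨h1, this.1, lt_of_le_of_ne this.2 h2⟩
    rw [this, measure_sdiff_null (cw_singleton 1), cw_cantor_measure]
    simp
  | succ k ih =>
    have ih' := ih (fun j => i j.succ)
    have hb := cw_triadic_bounds (fun j => i j.succ)
    rw [cw_triadic_cons, pow_succ]
    simp only [Fin.exists_fin_succ]
    set v := triadicVal (fun j => i j.succ) with hv
    obtain h | h | h : i 0 = 0 ∨ i 0 = 1 ∨ i 0 = 2 := by omega
    · have hset : cantorSet ∩ Set.Ico ((((i 0 : Fin 3) : ℕ) + v) / 3)
          ((((i 0 : Fin 3) : ℕ) + v) / 3 + (3⁻¹ : ℝ) ^ k * 3⁻¹) =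
          (fun x => (0 + x) / 3) '' (cantorSet ∩ Set.Ico v (v + (3⁻¹ : ℝ) ^ k)) := by
        ext x
        rw [h]
        simp only [Set.mem_inter_iff, Set.mem_Ico, Set.mem_image]
        constructor
        · rintro ⟨h1, h2, h3⟩
          norm_num at h2 h3
          rcases (cw_mem_cantor x).1 h1 with ⟨y, hy, rfl⟩ | ⟨y, hy, rfl⟩
          · exact ⟨y, ⟨hy, by linarith, by norm_num; linarith⟩, by ring⟩
          · have := (cantorSet_subset_unitInterval hy).1
            norm_num at hb
            exfalso; linarith
        · rintro ⟨y, ⟨hy, h2, h3⟩, rfl⟩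
          refine ⟨(cw_mem_cantor _).2 (Or.inl ⟨y, hy, by ring⟩), ?_, ?_⟩
          · norm_num; linarith
          · norm_num at h3 ⊢; linarith
      rw [hset, cw_scale, ih', ← ENNReal.ofReal_mul (by norm_num)]
      congr 1
      simp only [h, Fin.reduceEq, false_or]
      split_ifs <;> simp [pow_succ, mul_comm]
    · have hset : cantorSet ∩ Set.Ico ((((i 0 : Fin 3) : ℕ) + v) / 3)
          ((((i 0 : Fin 3) : ℕ) + v) / 3 + (3⁻¹ : ℝ) ^ k * 3⁻¹) ⊆ {1/3} := by
        rw [h]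
        rintro x ⟨h1, h2, h3⟩
        norm_num at h2 h3 hb
        rcases (cw_mem_cantor x).1 h1 with ⟨y, hy, rfl⟩ | ⟨y, hy, rfl⟩
        · have := (cantorSet_subset_unitInterval hy).2
          simp only [Set.mem_singleton_iff]
          linarith
        · have := (cantorSet_subset_unitInterval hy).1
          exfalso; linarith
      rw [measure_mono_null hset (cw_singleton _)]
      simp [h]
    · have hset : cantorSet ∩ Set.Ico ((((i 0 : Fin 3) : ℕ) + v) / 3)
          ((((i 0 : Fin 3) : ℕ) + v) / 3 + (3⁻¹ : ℝ) ^ k * 3⁻¹) =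
          (fun x => (2 + x) / 3) '' (cantorSet ∩ Set.Ico v (v + (3⁻¹ : ℝ) ^ k)) := by
        ext x
        rw [h]
        simp only [Set.mem_inter_iff, Set.mem_Ico, Set.mem_image]
        constructor
        · rintro ⟨h1, h2, h3⟩
          norm_num at h2 h3
          rcases (cw_mem_cantor x).1 h1 with ⟨y, hy, rfl⟩ | ⟨y, hy, rfl⟩
          · have := (cantorSet_subset_unitInterval hy).2
            norm_num at hb
            exfalso; linarith
          · exact ⟨y, ⟨hy, by linarith, by norm_num; linarith⟩, by ring⟩
        · rintro ⟨y, ⟨hy, h2, h3⟩, rfl⟩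
          refine ⟨(cw_mem_cantor _).2 (Or.inr ⟨y, hy, by ring⟩), ?_, ?_⟩
          · norm_num; linarith
          · norm_num at h3 ⊢; linarith
      rw [hset, cw_scale, ih', ← ENNReal.ofReal_mul (by norm_num)]
      congr 1
      simp only [h, Fin.reduceEq, false_or]
      split_ifs <;> simp [pow_succ, mul_comm]

theorem cw_grid (k j : ℕ) (hj : j < 3 ^ k) : ∃ i : Fin k → Fin 3,
    triadicVal i = (j : ℝ) * (3⁻¹:ℝ) ^ k := by
  induction k generalizing j with
  | zero =>
    refine ⟨fun _ => 0, ?_⟩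
    have : j = 0 := by simpa using hj
    simp [triadicVal, this]
  | succ k ih =>
    have hp : 0 < 3 ^ k := by positivity
    obtain ⟨i, hi⟩ := ih (j % 3 ^ k) (Nat.mod_lt _ hp)
    have hd : j / 3 ^ k < 3 := by
      rw [Nat.div_lt_iff_lt_mul hp, mul_comm, ← pow_succ]; exact hj
    refine ⟨Fin.cons ⟨j / 3 ^ k, hd⟩ i, ?_⟩
    rw [cw_triadic_cons]
    simp only [Fin.cons_zero, Fin.cons_succ]
    rw [hi]
    have hjj : (j : ℝ) = 3 ^ k * ((j / 3 ^ k : ℕ) : ℝ) + ((j % 3 ^ k : ℕ) : ℝ) := by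
      exact_mod_cast (Nat.div_add_mod j (3^k)).symm
    have h3 : (3:ℝ)^k * (3⁻¹)^k = 1 := by rw [← mul_pow]; norm_num
    have e : (j:ℝ) * (3⁻¹)^(k+1) = ((j / 3 ^ k : ℕ) : ℝ) * (3 ^ k * (3⁻¹)^k) / 3
        + ((j % 3 ^ k : ℕ) : ℝ) * (3⁻¹)^k / 3 := by
      conv_lhs => rw [hjj]
      rw [pow_succ]; ring
    rw [e, h3]; ring

theorem cw_unique (μ ν : Measure ℝ) [IsFiniteMeasure μ]
    (hμ : μ (Set.Ico (0 : ℝ) 1)ᶜ = 0) (hν : ν (Set.Ico (0 : ℝ) 1)ᶜ = 0)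
    (h : ∀ k : ℕ, 1 ≤ k → ∀ i : Fin k → Fin 3,
      μ (Set.Ico (triadicVal i) (triadicVal i + (3⁻¹ : ℝ) ^ k)) =
      ν (Set.Ico (triadicVal i) (triadicVal i + (3⁻¹ : ℝ) ^ k))) : μ = ν := by
  have hgrid : ∀ k : ℕ, 1 ≤ k → ∀ j : ℕ, j ≤ 3 ^ k →
      μ (Set.Iio ((j : ℝ) * (3⁻¹:ℝ)^k)) = ν (Set.Iio ((j : ℝ) * (3⁻¹:ℝ)^k)) := by
    intro k hk j
    induction j with
    | zero =>
      intro _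
      have hsub : Set.Iio (((0:ℕ) : ℝ) * (3⁻¹:ℝ)^k) ⊆ (Set.Ico (0 : ℝ) 1)ᶜ := by
        intro x hx hx2
        simp only [Nat.cast_zero, zero_mul, Set.mem_Iio] at hx
        exact absurd hx2.1 (not_le.2 hx)
      rw [measure_mono_null hsub hμ, measure_mono_null hsub hν]
    | succ j ih =>
      intro hj
      obtain ⟨i, hi⟩ := cw_grid k j (by omega)
      have hpos : (0:ℝ) < (3⁻¹:ℝ)^k := by positivity
      have e : Set.Iio (((j+1:ℕ) : ℝ) * (3⁻¹:ℝ)^k) = Set.Iio ((j : ℝ) * (3⁻¹:ℝ)^k) ∪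
          Set.Ico (triadicVal i) (triadicVal i + (3⁻¹ : ℝ) ^ k) := by
        rw [hi, Set.Iio_union_Ico_eq_Iio (by linarith)]
        congr 1; push_cast; ring
      have hdis : Disjoint (Set.Iio ((j : ℝ) * (3⁻¹:ℝ)^k))
          (Set.Ico (triadicVal i) (triadicVal i + (3⁻¹ : ℝ) ^ k)) := by
        rw [hi, Set.disjoint_left]
        intro x hx hx2
        exact absurd hx2.1 (not_le.2 hx)
      rw [e, measure_union hdis measurableSet_Ico, measure_union hdis measurableSet_Ico,
        ih (by omega), h k hk i]
  have h1 : μ (Set.Iio 1) = ν (Set.Iio 1) := by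
    have := hgrid 1 le_rfl 3 (by norm_num)
    norm_num at this
    exact this
  have hIci1 : ∀ x : ℝ, 1 ≤ x → μ (Set.Ici x) = ν (Set.Ici x) := by
    intro x hx
    have hsub : Set.Ici x ⊆ (Set.Ico (0 : ℝ) 1)ᶜ := by
      intro y hy hy2
      have : x ≤ y := hy
      linarith [hy2.2]
    rw [measure_mono_null hsub hμ, measure_mono_null hsub hν]
  have huniv : μ Set.univ = ν Set.univ := by
    have hd : Disjoint (Set.Iio (1:ℝ)) (Set.Ici 1) := by
      rw [Set.disjoint_left]; intro x hx hx2; exact absurd (Set.mem_Ici.1 hx2) (not_le.2 hx)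
    rw [← Set.Iio_union_Ici (a := (1:ℝ)), measure_union hd measurableSet_Ici,
      measure_union hd measurableSet_Ici, h1, hIci1 1 le_rfl]
  have hν' : IsFiniteMeasure ν := ⟨by rw [← huniv]; exact measure_lt_top _ _⟩
  have hIio : ∀ x : ℝ, x < 1 → μ (Set.Iio x) = ν (Set.Iio x) := by
    intro x hx
    rcases lt_or_ge x 0 with hx0 | hx0
    · have hsub : Set.Iio x ⊆ (Set.Ico (0 : ℝ) 1)ᶜ := by
        intro y hy hy2
        have : y < x := hy
        linarith [hy2.1]
      rw [measure_mono_null hsub hμ, measure_mono_null hsub hν]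
    · set p : ℕ → ℝ := fun k => (⌊(3:ℝ)^(k+1) * x⌋₊ : ℝ) * (3⁻¹:ℝ)^(k+1) with hp
      have h3 : ∀ k : ℕ, (3:ℝ)^k * (3⁻¹)^k = 1 := fun k => by rw [← mul_pow]; norm_num
      have hmono : Monotone p := by
        apply monotone_nat_of_le_succ
        intro k
        have hfl : 3 * ⌊(3:ℝ)^(k+1) * x⌋₊ ≤ ⌊(3:ℝ)^(k+2) * x⌋₊ := by
          apply Nat.le_floor
          push_cast
          have := Nat.floor_le (a := (3:ℝ)^(k+1) * x) (by positivity)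
          calc _ ≤ 3 * ((3:ℝ)^(k+1) * x) := by linarith
            _ = _ := by ring
        have hfl' : 3 * (⌊(3:ℝ)^(k+1) * x⌋₊ : ℝ) ≤ (⌊(3:ℝ)^(k+2) * x⌋₊ : ℝ) := by exact_mod_cast hfl
        calc p k = 3 * (⌊(3:ℝ)^(k+1) * x⌋₊ : ℝ) * (3⁻¹:ℝ)^(k+2) := by simp only [hp]; ring
          _ ≤ p (k+1) := by
            simp only [hp]
            gcongr
      have hle : ∀ k, p k ≤ x := by
        intro k
        have := Nat.floor_le (a := (3:ℝ)^(k+1) * x) (by positivity)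
        calc p k ≤ ((3:ℝ)^(k+1) * x) * (3⁻¹:ℝ)^(k+1) := by simp only [hp]; gcongr
          _ = ((3:ℝ)^(k+1) * (3⁻¹:ℝ)^(k+1)) * x := by ring
          _ = x := by rw [h3, one_mul]
      have hge : ∀ k, x - (3⁻¹:ℝ)^(k+1) ≤ p k := by
        intro k
        have := (Nat.lt_floor_add_one ((3:ℝ)^(k+1) * x)).le
        have h4 : ((3:ℝ)^(k+1) * x) * (3⁻¹:ℝ)^(k+1) ≤
            ((⌊(3:ℝ)^(k+1) * x⌋₊ : ℝ) + 1) * (3⁻¹:ℝ)^(k+1) := by gcongr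
        have h5 : ((3:ℝ)^(k+1) * x) * (3⁻¹:ℝ)^(k+1) = x := by
          calc _ = ((3:ℝ)^(k+1) * (3⁻¹:ℝ)^(k+1)) * x := by ring
            _ = x := by rw [h3, one_mul]
        simp only [hp]
        linarith
      have hU : Set.Iio x = ⋃ k, Set.Iio (p k) := by
        ext y
        simp only [Set.mem_Iio, Set.mem_iUnion]
        constructor
        · intro hy
          obtain ⟨n, hn⟩ := exists_pow_lt_of_lt_one (sub_pos.2 hy) (by norm_num : (3⁻¹:ℝ) < 1)
          refine ⟨n, ?_⟩
          have h6 : (3⁻¹:ℝ)^(n+1) ≤ (3⁻¹)^n :=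
            pow_le_pow_of_le_one (by norm_num) (by norm_num) (Nat.le_succ n)
          linarith [hge n]
        · rintro ⟨k, hk⟩
          exact hk.trans_le (hle k)
      have hm : Monotone fun k => Set.Iio (p k) := fun a b hab => Set.Iio_subset_Iio (hmono hab)
      rw [hU, hm.measure_iUnion, hm.measure_iUnion]
      congr 1
      ext k
      apply hgrid (k+1) (by omega)
      have : (⌊(3:ℝ)^(k+1) * x⌋₊ : ℝ) ≤ 3^(k+1) := by
        refine (Nat.floor_le (by positivity)).trans ?_
        have : (0:ℝ) < 3^(k+1) := by positivity
        nlinarith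
      exact_mod_cast this
  apply Measure.ext_of_Ici
  intro x
  rcases lt_or_ge x 1 with hx | hx
  · rw [← Set.compl_Iio, measure_compl measurableSet_Iio (measure_ne_top _ _),
      measure_compl measurableSet_Iio (measure_ne_top _ _), hIio x hx, huniv]
  · exact hIci1 x hx

/-- For `m₀(z) = (1+z²)/√2`, `m₁(z) = z`, `m₂(z) = (1−z²)/√2`, the
operators `(S_i f)(z) = m_i(z) f(z³)` on `L²(T)` form a representation of `𝒪₃`;
`‖S_{i_k}*⋯S_{i_1}* e₀‖²` equals `0` if some digit equals `1` and `2^{−k}` otherwise;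
and the unique Borel measure on `[0,1)` assigning these values to the triadic
intervals is the restriction to the middle-third Cantor set of the `s`-dimensional
Hausdorff measure, `s = log 2 / log 3`. -/
theorem cuntz_wavelet_stmt17
    (m : Fin 3 → AddCircle (1 : ℝ) → ℂ)
    (hm₀ : ∀ z, m 0 z = (1 + fourier (2 : ℤ) z) / (Real.sqrt 2 : ℂ))
    (hm₁ : ∀ z, m 1 z = fourier (1 : ℤ) z)
    (hm₂ : ∀ z, m 2 z = (1 - fourier (2 : ℤ) z) / (Real.sqrt 2 : ℂ))
    (S : Fin 3 → Lp ℂ 2 (@haarAddCircle (1 : ℝ) _) →L[ℂ] Lp ℂ 2 (@haarAddCircle (1 : ℝ) _))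
    (hS : ∀ (i : Fin 3) (f : Lp ℂ 2 (@haarAddCircle (1 : ℝ) _)),
      ⇑(S i f) =ᵐ[@haarAddCircle (1 : ℝ) _] fun z => m i z * f ((3 : ℕ) • z))
    (e₀ : Lp ℂ 2 (@haarAddCircle (1 : ℝ) _))
    (he₀ : ⇑e₀ =ᵐ[@haarAddCircle (1 : ℝ) _] fun _ => (1 : ℂ)) :
    ((∀ i j : Fin 3, adjoint (S i) * S j = if i = j then 1 else 0) ∧
      ∑ i : Fin 3, S i * adjoint (S i) = 1) ∧
    (∀ (k : ℕ), 1 ≤ k → ∀ i : Fin k → Fin 3,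
      ‖adjoint (cuntzWord3 S i) e₀‖ ^ 2 =
        if ∃ j, i j = 1 then 0 else (2⁻¹ : ℝ) ^ k) ∧
    ((μH[Real.log 2 / Real.log 3].restrict cantorSet) (Set.Ico (0 : ℝ) 1)ᶜ = 0 ∧
      (∀ (k : ℕ), 1 ≤ k → ∀ i : Fin k → Fin 3,
        (μH[Real.log 2 / Real.log 3].restrict cantorSet)
            (Set.Ico (triadicVal i) (triadicVal i + (3⁻¹ : ℝ) ^ k)) =
          ENNReal.ofReal (‖adjoint (cuntzWord3 S i) e₀‖ ^ 2)) ∧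
      ∀ μ₀ : Measure ℝ,
        (μ₀ (Set.Ico (0 : ℝ) 1)ᶜ = 0 ∧
          ∀ (k : ℕ), 1 ≤ k → ∀ i : Fin k → Fin 3,
            μ₀ (Set.Ico (triadicVal i) (triadicVal i + (3⁻¹ : ℝ) ^ k)) =
              ENNReal.ofReal (‖adjoint (cuntzWord3 S i) e₀‖ ^ 2)) →
        μ₀ = μH[Real.log 2 / Real.log 3].restrict cantorSet) := by
  have hops := cw_ops m hm₀ hm₁ hm₂ S hS
  have hab := cw_abstract (fourierLp (T := (1:ℝ)) 2) orthonormal_fourier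
    (span_fourierLp_closure_eq_top (by norm_num)) S
    (fun n => (hops n).1) (fun n => (hops n).2.1) (fun n => (hops n).2.2)
  have he : e₀ = fourierLp (T := (1:ℝ)) 2 0 := by
    apply Lp.ext
    filter_upwards [he₀, coeFn_fourierLp (T := (1:ℝ)) 2 0] with z h1 h2
    rw [h1, h2, fourier_zero]
  have hnorm : ‖e₀‖ = 1 := by
    rw [he]; exact orthonormal_fourier.1 0
  have hN := cw_norm e₀ hnorm S (by rw [he]; exact hab.2)
  have hnull : (μH[Real.log 2 / Real.log 3].restrict cantorSet) (Set.Ico (0 : ℝ) 1)ᶜ = 0 := by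
    rw [Measure.restrict_apply measurableSet_Ico.compl]
    refine measure_mono_null ?_ (cw_singleton 1)
    rintro x ⟨h1, h2⟩
    have := cantorSet_subset_unitInterval h2
    rcases this.2.lt_or_eq with h | h
    · exact absurd ⟨this.1, h⟩ h1
    · exact h
  have hI : ∀ (k : ℕ), 1 ≤ k → ∀ i : Fin k → Fin 3,
        (μH[Real.log 2 / Real.log 3].restrict cantorSet)
            (Set.Ico (triadicVal i) (triadicVal i + (3⁻¹ : ℝ) ^ k)) =
          ENNReal.ofReal (‖adjoint (cuntzWord3 S i) e₀‖ ^ 2) := by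
    intro k _ i
    rw [Measure.restrict_apply measurableSet_Ico, Set.inter_comm, hN k i]
    exact cw_interval i
  refine ⟨hab.1, fun k _ i => hN k i, hnull, hI, ?_⟩
  rintro μ₀ ⟨h1, h2⟩
  have hfin : IsFiniteMeasure (μH[Real.log 2 / Real.log 3].restrict cantorSet : Measure ℝ) := by
    constructor
    rw [Measure.restrict_apply_univ]
    have := cw_cantor_measure
    rw [cwS] at this
    rw [this]
    exact ENNReal.one_lt_top
  symm
  apply cw_unique _ _ hnull h1
  intro k hk i
  rw [hI k hk i, h2 k hk i]
end
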